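/- Let A ∈ ℤ^{m×n} with m ≥ 2, let k be the tropical rank of A, and let R := max_{1≤i≤m} ( max_{1≤j≤n}(A_{ij} − A_{1j}) − min_{1≤j≤n}(A_{ij} − A_{1j}) ). Then for every real ε with 0 < ε ≤ R√(m−1), the Lebesgue measure of tconv(A) + B_H(ε) ⊆ ℝ^{m−1} is at least 2^{(k−m)/2} · κ_{m−k} · k^{2−k} · ε^{m−k}. -/

import Mathlib

open MeasureTheory Pointwise

noncomputable section

/-- Hilbert ball of radius `δ` in `ℝ^n` (chart coordinates). -/
def hilbertBall (n : ℕ) (δ : ℝ) : Set (Fin n → ℝ) :=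
  {y | max 0 (⨆ i, y i) - min 0 (⨅ i, y i) ≤ δ}

/-- Tropical (min-plus) convex hull of the columns of a matrix `A`, viewed in the chart
`x ↦ (x_2 − x_1, …, x_m − x_1)`, i.e. as a subset of `ℝ^(m-1)`. -/
def tconv (m : ℕ) {ι : Type*} (A : Fin m → ι → ℝ) : Set (Fin (m - 1) → ℝ) :=
  {y | ∃ α : ι → ℝ, ∀ k : Fin (m - 1),
      y k = (⨅ j, (α j + A ⟨(k : ℕ) + 1, by have := k.isLt; omega⟩ j))
          - (⨅ j, (α j + A ⟨0, by have := k.isLt; omega⟩ j))}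

/-- A square matrix is tropically nonsingular if the minimum over permutations `σ` of
`∑ i, M i (σ i)` is attained by exactly one permutation. -/
def TropNonsingular {k : ℕ} (M : Fin k → Fin k → ℝ) : Prop :=
  ∃! σ : Equiv.Perm (Fin k), ∀ τ : Equiv.Perm (Fin k),
    ∑ i, M i (σ i) ≤ ∑ i, M i (τ i)

/-- The tropical rank of `A`: the largest `k` such that `A` has a tropically
nonsingular `k × k` submatrix. -/
def tropRank (m n : ℕ) (A : Fin m → Fin n → ℝ) : ℕ :=
  sSup {k : ℕ | ∃ r : Fin k → Fin m, ∃ c : Fin k → Fin n,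
    Function.Injective r ∧ Function.Injective c ∧
    TropNonsingular (fun i j => A (r i) (c j))}


/-- `kappa d` is the Lebesgue volume of the `d`-dimensional Euclidean unit ball,
`π^(d/2) / Γ(d/2 + 1)`. -/
def kappa (d : ℕ) : ℝ := Real.pi ^ ((d : ℝ) / 2) / Real.Gamma ((d : ℝ) / 2 + 1)

lemma mem_hilbertBall_iff {n : ℕ} {δ : ℝ} (hδ : 0 ≤ δ) (y : Fin n → ℝ) :
    y ∈ hilbertBall n δ ↔ (∀ i, y i ≤ δ ∧ -y i ≤ δ) ∧ ∀ i j, y i - y j ≤ δ := by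
  rcases isEmpty_or_nonempty (Fin n) with h | h
  · simp [hilbertBall, hδ]
  · have hle : ∀ i, y i ≤ ⨆ i, y i := fun i => le_ciSup (Set.finite_range y).bddAbove i
    have hge : ∀ i, ⨅ i, y i ≤ y i := fun i => ciInf_le (Set.finite_range y).bddBelow i
    obtain ⟨a, ha⟩ := exists_eq_ciSup_of_finite (f := y)
    obtain ⟨b, hb⟩ := exists_eq_ciInf_of_finite (f := y)
    simp only [hilbertBall, Set.mem_ofPred_eq]
    constructor
    · intro H
      have h1 := le_max_left 0 (⨆ i, y i)
      have h2 := le_max_right 0 (⨆ i, y i)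
      have h3 := min_le_left 0 (⨅ i, y i)
      have h4 := min_le_right 0 (⨅ i, y i)
      refine ⟨fun i => ⟨?_, ?_⟩, fun i j => ?_⟩
      · linarith [hle i]
      · linarith [hge i]
      · linarith [hle i, hge j]
    · rintro ⟨H1, H2⟩
      rw [← ha, ← hb]
      have := H1 a
      have := H1 b
      have := H2 a b
      rcases max_cases 0 (y a) with h | h <;> rcases min_cases 0 (y b) with h' | h' <;> linarith

/-- The coordinate change between the charts `x ↦ x_l - x_0` and `x ↦ x_l - x_j` of
`ℝ^(d+1)` modulo the diagonal. -/
def chartFlip {d : ℕ} (j : Fin d) : (Fin d → ℝ) →ₗ[ℝ] (Fin d → ℝ) where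
  toFun y l := (if l = j then 0 else y l) - y j
  map_add' x y := by
    ext l
    by_cases h : l = j
    · simp [h]
      ring
    · simp [h]
      ring
  map_smul' c y := by
    ext l
    by_cases h : l = j
    · simp [h]
    · simp [h]
      ring

lemma chartFlip_apply {d : ℕ} (j : Fin d) (y : Fin d → ℝ) (l : Fin d) :
    chartFlip j y l = (if l = j then 0 else y l) - y j := rfl

lemma chartFlip_chartFlip {d : ℕ} (j : Fin d) (y : Fin d → ℝ) :
    chartFlip j (chartFlip j y) = y := by
  ext l
  by_cases h : l = j <;> simp [chartFlip_apply, h]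

lemma volume_preimage_chartFlip {d : ℕ} (j : Fin d) (s : Set (Fin d → ℝ)) :
    volume (chartFlip j ⁻¹' s) = volume s := by
  have hcomp : chartFlip j ∘ₗ chartFlip j = LinearMap.id :=
    LinearMap.ext fun y => chartFlip_chartFlip j y
  have hdet : LinearMap.det (chartFlip j) * LinearMap.det (chartFlip j) = 1 := by
    rw [← LinearMap.det_comp, hcomp, LinearMap.det_id]
  have habs : |LinearMap.det (chartFlip j)| = 1 := by
    rcases mul_self_eq_one_iff.mp hdet with h | h <;> simp [h]
  rw [Measure.addHaar_preimage_linearMap _ (fun h => by simp [h] at hdet), abs_inv, habs]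
  simp

lemma chartFlip_mem_hilbertBall {d : ℕ} (j : Fin d) {δ : ℝ} (hδ : 0 ≤ δ) {y : Fin d → ℝ}
    (hy : y ∈ hilbertBall d δ) : chartFlip j y ∈ hilbertBall d δ := by
  rw [mem_hilbertBall_iff hδ] at hy ⊢
  obtain ⟨h1, h2⟩ := hy
  refine ⟨fun i => ?_, fun i l => ?_⟩
  · have := h1 j
    have := h2 i j
    have := h2 j i
    rw [chartFlip_apply]
    split_ifs <;> constructor <;> linarith
  · have := h1 i
    have := h1 l
    have := h2 i l
    simp only [chartFlip_apply]
    split_ifs <;> linarith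

lemma le_volume_hilbertBall (q : ℕ) {δ : ℝ} (hδ : 0 ≤ δ) :
    ENNReal.ofReal ((q + 1) * δ ^ q) ≤ volume (hilbertBall q δ) := by
  set Q : Set (Fin q → ℝ) := Set.pi Set.univ fun _ => Set.Ioo 0 δ with hQ
  have hQvol : volume Q = ENNReal.ofReal (δ ^ q) := by
    rw [hQ, Real.volume_pi_Ioo]
    simp [ENNReal.ofReal_pow hδ]
  have hQmeas : MeasurableSet Q := MeasurableSet.univ_pi fun _ => measurableSet_Ioo
  have hQsub : Q ⊆ hilbertBall q δ := by
    intro y hy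
    simp only [hQ, Set.mem_pi, Set.mem_univ, true_implies, Set.mem_Ioo] at hy
    rw [mem_hilbertBall_iff hδ]
    exact ⟨fun i => by have := hy i; constructor <;> linarith,
      fun i j => by have := hy i; have := hy j; linarith⟩
  let C : Option (Fin q) → Set (Fin q → ℝ) := fun o => o.elim Q fun j => chartFlip j ⁻¹' Q
  have hCvol : ∀ o, volume (C o) = ENNReal.ofReal (δ ^ q) := by
    rintro (_ | j)
    · exact hQvol
    · exact (volume_preimage_chartFlip j Q).trans hQvol
  have hCmeas : ∀ o, MeasurableSet (C o) := by
    rintro (_ | j)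
    · exact hQmeas
    · exact (LinearMap.continuous_of_finiteDimensional _).measurable hQmeas
  have hCsub : ∀ o, C o ⊆ hilbertBall q δ := by
    rintro (_ | j)
    · exact hQsub
    · intro y hy
      rw [← chartFlip_chartFlip j y]
      exact chartFlip_mem_hilbertBall j hδ (hQsub hy)
  have hsome : ∀ j, ∀ y ∈ C (some j), y j < 0 ∧ ∀ i, i ≠ j → y j < y i := by
    intro j y hy
    have hy' : ∀ i, chartFlip j y i ∈ Set.Ioo 0 δ := fun i => hy i (Set.mem_univ i)
    refine ⟨?_, fun i hij => ?_⟩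
    · have := (hy' j).1
      simp only [chartFlip_apply, if_true] at this
      linarith
    · have := (hy' i).1
      simp only [chartFlip_apply, if_neg hij] at this
      linarith
  have hnone : ∀ y ∈ C none, ∀ i, 0 < y i := fun y hy i => (hy i (Set.mem_univ i)).1
  have hdisj : Pairwise (Function.onFun Disjoint C) := by
    intro o o' hne
    refine Set.disjoint_left.mpr fun y hy hy' => ?_
    rcases o with _ | i <;> rcases o' with _ | j
    · exact hne rfl
    · linarith [hnone y hy j, (hsome j y hy').1]
    · linarith [hnone y hy' i, (hsome i y hy).1]
    · have hij : i ≠ j := fun h => hne (by rw [h])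
      linarith [(hsome i y hy).2 j hij.symm, (hsome j y hy').2 i hij]
  calc ENNReal.ofReal ((q + 1) * δ ^ q) = volume (⋃ o, C o) := by
        rw [measure_iUnion hdisj hCmeas, tsum_fintype, Finset.sum_congr rfl fun o _ => hCvol o,
          Finset.sum_const, Finset.card_univ, Fintype.card_option, Fintype.card_fin,
          nsmul_eq_mul, ENNReal.ofReal_mul (by positivity)]
        congr 1
        exact_mod_cast ENNReal.ofReal_natCast (q + 1)
    _ ≤ volume (hilbertBall q δ) := measure_mono (Set.iUnion_subset hCsub)

/-- Egerváry duality: if the identity is an optimal assignment for the integer weights `w`, it is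
certified by integer potentials. -/
lemma exists_potential {k : ℕ} (w : Fin k → Fin k → ℤ) (hw : ∀ a, w a a = 0)
    (hσ : ∀ σ : Equiv.Perm (Fin k), 0 ≤ ∑ a, w a (σ a)) :
    ∃ p : Fin k → ℤ, ∀ a b, p a ≤ p b + w a b := by
  rcases Nat.eq_zero_or_pos k with rfl | hk
  · exact ⟨0, fun a => a.elim0⟩
  have : Nonempty (Fin k) := ⟨⟨0, hk⟩⟩
  let μ : (Fin k → ℤ) → Fin k → ℤ := fun p a =>
    Finset.univ.inf' Finset.univ_nonempty fun b => p b + w a b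
  have hμle : ∀ p a b, μ p a ≤ p b + w a b := fun p a b => Finset.inf'_le _ (Finset.mem_univ b)
  have hμself : ∀ p a, μ p a ≤ p a := fun p a => by simpa [hw] using hμle p a a
  let F : (Fin k → ℤ) → ℤ := fun p => ∑ a, μ p a - ∑ a, p a
  have hF : ∀ p, F p ≤ 0 := fun p => sub_nonpos.mpr (Finset.sum_le_sum fun a _ => hμself p a)
  obtain ⟨_, ⟨p, rfl⟩, hmax⟩ := Int.exists_greatest_of_bdd (P := fun z => ∃ p, F p = z)
    ⟨0, by rintro _ ⟨p, rfl⟩; exact hF p⟩ ⟨F 0, 0, rfl⟩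
  let t : Fin k → Finset (Fin k) := fun a => {b | p b + w a b = μ p a}
  have hall : ∀ s : Finset (Fin k), s.card ≤ (s.biUnion t).card := by
    intro s
    set N := s.biUnion t with hN
    let p' : Fin k → ℤ := fun b => p b + if b ∈ N then 1 else 0
    have hstep : ∀ a, μ p a + (if a ∈ s then 1 else 0) ≤ μ p' a := by
      intro a
      refine Finset.le_inf' _ _ fun b _ => ?_
      have hab := hμle p a b
      by_cases hb : b ∈ N
      · simp only [p', if_pos hb]
        split_ifs <;> linarith
      · simp only [p', if_neg hb]
        split_ifs with ha
        · have hne : p b + w a b ≠ μ p a := fun h =>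
            hb (Finset.mem_biUnion.mpr ⟨a, ha, by simp [t, h]⟩)
          omega
        · linarith
    have h1 : ∑ a, μ p a + s.card ≤ ∑ a, μ p' a := by
      have := Finset.sum_le_sum fun a (_ : a ∈ Finset.univ) => hstep a
      simpa [Finset.sum_add_distrib] using this
    have h2 : ∑ a, p' a = ∑ a, p a + N.card := by
      simp [p', Finset.sum_add_distrib]
    have h3 : F p' ≤ F p := hmax _ ⟨p', rfl⟩
    simp only [F] at h3
    omega
  obtain ⟨f, hf, hft⟩ := (Finset.all_card_le_biUnion_card_iff_exists_injective t).mp hall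
  let σ : Equiv.Perm (Fin k) := Equiv.ofBijective f (Finite.injective_iff_bijective.mp hf)
  have hsum : ∑ a, μ p a = ∑ a, p a + ∑ a, w a (σ a) := by
    rw [← Equiv.sum_comp σ p, ← Finset.sum_add_distrib]
    refine Finset.sum_congr rfl fun a _ => ?_
    have := hft a
    simp only [t, Finset.mem_filter, Finset.mem_univ, true_and] at this
    exact this.symm
  have hle : ∑ a, p a ≤ ∑ a, μ p a := by linarith [hσ σ]
  refine ⟨p, fun a b => ?_⟩
  have heq := (Finset.sum_eq_sum_iff_of_le fun a _ => hμself p a).mp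
    (le_antisymm (Finset.sum_le_sum fun a _ => hμself p a) hle) a (Finset.mem_univ a)
  exact heq ▸ hμle p a b

lemma measurableSet_hilbertBall (n : ℕ) {δ : ℝ} (hδ : 0 ≤ δ) :
    MeasurableSet (hilbertBall n δ) := by
  have : hilbertBall n δ = {y | (∀ i, y i ≤ δ ∧ -y i ≤ δ) ∧ ∀ i j, y i - y j ≤ δ} :=
    Set.ext fun y => mem_hilbertBall_iff hδ y
  rw [this]
  measurability

lemma kappa_mul_pow_le_volume_hilbertBall (r : ℕ) {ε : ℝ} (hε : 0 ≤ ε) :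
    ENNReal.ofReal (kappa r * (ε / √2) ^ r) ≤ volume (hilbertBall r ε) := by
  have hρ : 0 ≤ ε / √2 := by positivity
  have hρsq : 2 * (ε / √2) ^ 2 = ε ^ 2 := by
    rw [div_pow, Real.sq_sqrt (by norm_num)]
    ring
  rcases Nat.eq_zero_or_pos r with rfl | hr
  · have : hilbertBall 0 ε = Set.univ :=
      Set.eq_univ_of_forall fun y => (mem_hilbertBall_iff hε y).mpr
        ⟨fun i => i.elim0, fun i => i.elim0⟩
    simp [this, kappa, Measure.volume_pi_eq_dirac (0 : Fin 0 → ℝ)]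
  have : Nonempty (Fin r) := ⟨⟨0, hr⟩⟩
  have hκ : kappa r = √Real.pi ^ r / Real.Gamma (r / 2 + 1) := by
    rw [kappa, Real.sqrt_eq_rpow, ← Real.rpow_mul_natCast Real.pi_pos.le]
    congr 2
    ring
  have hvol : volume (Metric.closedBall (0 : EuclideanSpace ℝ (Fin r)) (ε / √2)) =
      ENNReal.ofReal (kappa r * (ε / √2) ^ r) := by
    rw [EuclideanSpace.volume_closedBall, Fintype.card_fin, ← ENNReal.ofReal_pow hρ,
      ← ENNReal.ofReal_mul (by positivity), hκ, mul_comm]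
  rw [← hvol, ← (PiLp.volume_preserving_ofLp (Fin r)).measure_preimage
    (measurableSet_hilbertBall r hε).nullMeasurableSet]
  refine measure_mono fun x hx => ?_
  rw [mem_closedBall_zero_iff] at hx
  have hsum : ∑ i, x i ^ 2 ≤ (ε / √2) ^ 2 := by
    have := EuclideanSpace.norm_sq_eq x
    simp only [Real.norm_eq_abs, sq_abs] at this
    rw [← this]
    gcongr
  have hone : ∀ i, x i ^ 2 ≤ (ε / √2) ^ 2 := fun i =>
    (Finset.single_le_sum (f := fun i => x i ^ 2) (fun i _ => sq_nonneg _)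
      (Finset.mem_univ i)).trans hsum
  have habs : ∀ i, |x i| ≤ ε := fun i =>
    abs_le_of_sq_le_sq (by nlinarith [hone i, sq_nonneg (ε / √2)]) hε
  refine (mem_hilbertBall_iff hε _).mpr ⟨fun i => ?_, fun i j => ?_⟩
  · exact ⟨(le_abs_self _).trans (habs i), (neg_le_abs _).trans (habs i)⟩
  · by_cases hij : i = j
    · simpa [hij] using hε
    · have h2 : x i ^ 2 + x j ^ 2 ≤ (ε / √2) ^ 2 := by
        have := Finset.sum_le_sum_of_subset_of_nonneg (Finset.subset_univ {i, j})
          (f := fun i => x i ^ 2) fun i _ _ => sq_nonneg _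
        rw [Finset.sum_pair hij] at this
        exact this.trans hsum
      refine (le_abs_self _).trans (abs_le_of_sq_le_sq ?_ hε)
      change (x i - x j) ^ 2 ≤ ε ^ 2
      nlinarith [sq_nonneg (x i + x j)]

/-- If the projection of `Y` to the coordinates `s` covers a translate of a Hilbert ball, then
Fubini bounds the volume of the outer parallel body of `Y` from below. -/
lemma volume_hilbertBall_mul_le {d q : ℕ} (Y : Set (Fin d → ℝ)) (s : Fin q → Fin d)
    (hs : Function.Injective s) (v : Fin q → ℝ) {δ ε : ℝ} (hδ : 0 ≤ δ) (hε : 0 ≤ ε)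
    (hY : ∀ u ∈ hilbertBall q δ, ∃ y ∈ Y, ∀ a, y (s a) = v a + u a) :
    volume (hilbertBall q δ) * volume (hilbertBall (d - q) ε) ≤
      volume (Y + hilbertBall d ε) := by
  classical
  obtain ⟨e, he⟩ : ∃ e : Fin q ⊕ Fin (d - q) ≃ Fin d, ∀ a, e (Sum.inl a) = s a := by
    have hcard : Fintype.card {l // l ∉ Set.range s} = d - q := by
      have hrange : Fintype.card {l // l ∈ Set.range s} = q := by
        rw [← Fintype.card_congr (Equiv.ofInjective s hs), Fintype.card_fin]
      rw [Fintype.card_subtype_compl, Fintype.card_fin, hrange]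
    refine ⟨(Equiv.sumCongr (Equiv.ofInjective s hs)
      (Fintype.equivFinOfCardEq hcard).symm).trans (Equiv.sumCompl (· ∈ Set.range s)), ?_⟩
    intro a
    simp
  set E := Y + hilbertBall d ε with hE
  let Φ : (Fin q → ℝ) × (Fin (d - q) → ℝ) → (Fin d → ℝ) := fun z =>
    MeasurableEquiv.piCongrLeft (fun _ => ℝ) e
      ((MeasurableEquiv.sumPiEquivProdPi fun _ => ℝ).symm z)
  have hΦ : MeasurePreserving Φ :=
    (volume_measurePreserving_piCongrLeft (fun _ => ℝ) e).comp
      (volume_measurePreserving_sumPiEquivProdPi_symm fun _ => ℝ)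
  have hΦl : ∀ z a, Φ z (e (Sum.inl a)) = z.1 a := fun z a => by
    simp [Φ, MeasurableEquiv.coe_piCongrLeft, MeasurableEquiv.sumPiEquivProdPi]
  have hΦr : ∀ z b, Φ z (e (Sum.inr b)) = z.2 b := fun z b => by
    simp [Φ, MeasurableEquiv.coe_piCongrLeft, MeasurableEquiv.sumPiEquivProdPi]
  set H := toMeasurable volume E
  have hH : MeasurableSet H := measurableSet_toMeasurable _ _
  set S : Set (Fin q → ℝ) := (fun u => u - v) ⁻¹' hilbertBall q δ with hS
  have hSmeas : MeasurableSet S :=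
    (measurable_id.sub_const v) (measurableSet_hilbertBall q hδ)
  have hSvol : volume S = volume (hilbertBall q δ) := by
    simp only [hS, sub_eq_add_neg]
    exact measure_preimage_add_right _ _ _
  have hslice : ∀ u ∈ S, volume (hilbertBall (d - q) ε) ≤ volume (Prod.mk u ⁻¹' (Φ ⁻¹' H)) := by
    intro u hu
    obtain ⟨y, hyY, hy⟩ := hY _ hu
    have hvol := measure_preimage_add_right volume (-fun b => y (e (Sum.inr b)))
      (hilbertBall (d - q) ε)
    rw [← hvol]
    refine measure_mono fun w hw => subset_toMeasurable _ _ ?_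
    refine ⟨y, hyY, Φ (u, w) - y, ?_, add_sub_cancel _ _⟩
    have hl : ∀ a, (Φ (u, w) - y) (e (Sum.inl a)) = 0 := fun a => by
      rw [Pi.sub_apply, hΦl, he, hy]
      simp
    have hr : ∀ b, (Φ (u, w) - y) (e (Sum.inr b)) = (w + -fun b => y (e (Sum.inr b))) b :=
      fun b => by
        rw [Pi.sub_apply, hΦr]
        simp [sub_eq_add_neg]
    have hw' := (mem_hilbertBall_iff hε _).mp hw
    refine (mem_hilbertBall_iff hε _).mpr ⟨fun i => ?_, fun i j => ?_⟩
    · obtain ⟨i | i, rfl⟩ := e.surjective i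
      · simpa [hl] using hε
      · rw [hr]
        exact hw'.1 i
    · obtain ⟨i | i, rfl⟩ := e.surjective i <;> obtain ⟨j | j, rfl⟩ := e.surjective j
      · simpa [hl] using hε
      · rw [hl, hr, zero_sub]
        exact (hw'.1 j).2
      · rw [hl, hr, sub_zero]
        exact (hw'.1 i).1
      · rw [hr, hr]
        exact hw'.2 i j
  calc volume (hilbertBall q δ) * volume (hilbertBall (d - q) ε)
      = ∫⁻ _ in S, volume (hilbertBall (d - q) ε) := by
        rw [setLIntegral_const, hSvol, mul_comm]
    _ ≤ ∫⁻ u in S, volume (Prod.mk u ⁻¹' (Φ ⁻¹' H)) := setLIntegral_mono' hSmeas hslice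
    _ ≤ ∫⁻ u, volume (Prod.mk u ⁻¹' (Φ ⁻¹' H)) := setLIntegral_le_lintegral _ _
    _ = volume (Φ ⁻¹' H) := (Measure.prod_apply (hΦ.measurable hH)).symm
    _ = volume H := hΦ.measure_preimage hH.nullMeasurableSet
    _ = volume E := measure_toMeasurable E

/-- The chart `x ↦ (x_l - x_0)_l` of `ℝ^(d+1)` modulo the diagonal. -/
def chart {d : ℕ} (x : Fin (d + 1) → ℝ) : Fin d → ℝ := fun l => x l.succ - x 0

lemma chart_comp_swap {d : ℕ} (j : Fin d) (x : Fin (d + 1) → ℝ) :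
    chart (x ∘ Equiv.swap 0 j.succ) = chartFlip j (chart x) := by
  ext l
  simp only [chart, chartFlip_apply, Function.comp_apply, Equiv.swap_apply_left]
  by_cases h : l = j
  · simp [h]
  · rw [Equiv.swap_apply_of_ne_of_ne (Fin.succ_ne_zero l) (by simpa using h), if_neg h]
    ring

lemma volume_chart_image_comp_swap_le {d : ℕ} (i : Fin (d + 1)) (T : Set (Fin (d + 1) → ℝ))
    {ε : ℝ} (hε : 0 ≤ ε) :
    volume (chart '' ((fun x => x ∘ Equiv.swap 0 i) '' T) + hilbertBall d ε) ≤
      volume (chart '' T + hilbertBall d ε) := by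
  induction i using Fin.cases with
  | zero => simp
  | succ j =>
    rw [← volume_preimage_chartFlip j (chart '' T + hilbertBall d ε)]
    refine measure_mono ?_
    rintro _ ⟨_, ⟨_, ⟨x, hx, rfl⟩, rfl⟩, b, hb, rfl⟩
    refine ⟨chart x, ⟨x, hx, rfl⟩, chartFlip j b, chartFlip_mem_hilbertBall j hε hb, ?_⟩
    simp only [map_add, chart_comp_swap, chartFlip_chartFlip]

lemma volume_chart_image_add_hilbertBall_ge {d q : ℕ} (T : Set (Fin (d + 1) → ℝ))
    (r : Fin (q + 1) → Fin (d + 1)) (hr : Function.Injective r) (v : Fin (q + 1) → ℝ) {δ ε : ℝ}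
    (hδ : 0 ≤ δ) (hε : 0 ≤ ε)
    (hT : ∀ t : Fin (q + 1) → ℝ, (∀ a b, t a - t b ≤ δ) → ∃ x ∈ T, ∀ a, x (r a) = v a + t a) :
    volume (hilbertBall q δ) * volume (hilbertBall (d - q) ε) ≤
      volume (chart '' T + hilbertBall d ε) := by
  refine le_trans ?_ (volume_chart_image_comp_swap_le (r 0) T hε)
  have hne : ∀ a : Fin q, Equiv.swap 0 (r 0) (r a.succ) ≠ 0 := fun a h => by
    rw [Equiv.swap_apply_eq_iff, Equiv.swap_apply_left] at h
    exact Fin.succ_ne_zero a (hr h)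
  choose s hs using fun a => Fin.exists_succ_eq.mpr (hne a)
  refine volume_hilbertBall_mul_le _ s ?_ (fun a => v a.succ - v 0) hδ hε fun u hu => ?_
  · intro a b hab
    have := hs a
    rw [hab, hs b] at this
    exact (Fin.succ_injective _ (hr ((Equiv.swap _ _).injective this))).symm
  · rw [mem_hilbertBall_iff hδ] at hu
    obtain ⟨x, hxT, hx⟩ := hT (Fin.cons 0 u) fun a b => by
      induction a using Fin.cases <;> induction b using Fin.cases <;>
        simp [hδ, hu.2, hu.1]
    refine ⟨_, ⟨_, ⟨x, hxT, rfl⟩, rfl⟩, fun a => ?_⟩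
    simp only [chart, Function.comp_apply, hs, Equiv.swap_apply_self, Equiv.swap_apply_left, hx]
    simp
    ring

/-- A tropically nonsingular integer submatrix has a tropical span that contains a Hilbert ball of
radius `1 / k`, after projection to the rows of the submatrix. -/
lemma exists_tropical_combination {m n k : ℕ} (A : Fin m → Fin n → ℤ) (r : Fin k → Fin m)
    (c : Fin k → Fin n) (hk : 0 < k) (hc : Function.Injective c)
    (h : TropNonsingular fun i j => (A (r i) (c j) : ℝ)) :
    ∃ v : Fin k → ℝ, ∀ t : Fin k → ℝ, (∀ a b, t a - t b ≤ 1 / k) →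
      ∃ α : Fin n → ℝ, ∀ a, ⨅ j, (α j + A (r a) j) = v a + t a := by
  obtain ⟨σ, hσ, huniq⟩ := h
  have hlt : ∀ τ : Equiv.Perm (Fin k), τ ≠ σ →
      ∑ a, A (r a) (c (σ a)) < ∑ a, A (r a) (c (τ a)) := by
    intro τ hτ
    by_contra! hle
    have hle' : ∑ a, (A (r a) (c (τ a)) : ℝ) ≤ ∑ a, (A (r a) (c (σ a)) : ℝ) := by
      exact_mod_cast hle
    exact hτ (huniq τ fun ρ => hle'.trans (hσ ρ))
  obtain ⟨p, hp⟩ := exists_potential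
    (fun a b => if a = b then 0 else k * (A (r a) (c (σ b)) - A (r a) (c (σ a))) - 1)
    (by simp) (by
      intro τ
      by_cases hτ : τ = 1
      · simp [hτ]
      have h1 := hlt (σ * τ) (by simpa using hτ)
      calc (0 : ℤ) ≤ k * (∑ a, A (r a) (c ((σ * τ) a)) - ∑ a, A (r a) (c (σ a))) - k := by
            nlinarith
        _ = ∑ a, (k * (A (r a) (c (σ (τ a))) - A (r a) (c (σ a))) - 1) := by
            simp [Finset.sum_sub_distrib, ← Finset.mul_sum]
        _ ≤ _ := by
            refine Finset.sum_le_sum fun a _ => ?_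
            split_ifs with ha
            · simp [← ha]
            · exact le_rfl)
  have hk' : (0 : ℝ) < k := by exact_mod_cast hk
  have hpot : ∀ a b, a ≠ b → (p a : ℝ) / k + A (r a) (c (σ a)) + 1 / k ≤
      p b / k + A (r a) (c (σ b)) := by
    intro a b hab
    have h1 := hp a b
    rw [if_neg hab] at h1
    have h2 : (p a : ℝ) ≤ p b + (k * (A (r a) (c (σ b)) - A (r a) (c (σ a))) - 1) := by
      exact_mod_cast h1
    have h3 := div_le_div_of_nonneg_right h2 hk'.le
    have h4 : (p b + (k * ((A (r a) (c (σ b)) : ℝ) - A (r a) (c (σ a))) - 1)) / k =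
      p b / k + (A (r a) (c (σ b)) - A (r a) (c (σ a))) - 1 / k := by
      field_simp
      ring
    linarith
  refine ⟨fun a => p a / k + A (r a) (c (σ a)), fun t ht => ?_⟩
  have hinj : Function.Injective fun a => c (σ a) := hc.comp σ.injective
  obtain ⟨L, hL⟩ : ∃ L : ℝ, ∀ a j, (p a : ℝ) / k + A (r a) (c (σ a)) + t a - A (r a) j ≤ L := by
    obtain ⟨L, hL⟩ := (Set.finite_range fun z : Fin k × Fin n =>
      (p z.1 : ℝ) / k + A (r z.1) (c (σ z.1)) + t z.1 - A (r z.1) z.2).bddAbove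
    exact ⟨L, fun a j => hL ⟨(a, j), rfl⟩⟩
  refine ⟨Function.extend (fun a => c (σ a)) (fun b => p b / k + t b) fun _ => L, fun a => ?_⟩
  refine IsLeast.csInf_eq ⟨⟨c (σ a), ?_⟩, ?_⟩
  · have := hinj.extend_apply (fun b => (p b : ℝ) / k + t b) (fun _ => L) a
    simp only at this ⊢
    rw [this]
    ring
  · rintro _ ⟨j, rfl⟩
    by_cases hj : ∃ b, c (σ b) = j
    · obtain ⟨b, rfl⟩ := hj
      have := hinj.extend_apply (fun b => (p b : ℝ) / k + t b) (fun _ => L) b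
      simp only at this ⊢
      rw [this]
      by_cases hab : a = b
      · subst hab
        linarith
      · linarith [hpot a b hab, ht a b]
    · simp only
      rw [Function.extend_apply' _ _ _ hj]
      linarith [hL a j]

lemma exists_tropNonsingular_of_eq_tropRank {m n k : ℕ} (hm : 0 < m) (hn : 0 < n)
    (A : Fin m → Fin n → ℝ) (hk : k = tropRank m n A) :
    1 ≤ k ∧ ∃ r : Fin k → Fin m, ∃ c : Fin k → Fin n,
      Function.Injective r ∧ Function.Injective c ∧
      TropNonsingular (fun i j => A (r i) (c j)) := by
  set K := {k : ℕ | ∃ r : Fin k → Fin m, ∃ c : Fin k → Fin n,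
    Function.Injective r ∧ Function.Injective c ∧
    TropNonsingular (fun i j => A (r i) (c j))}
  have h1 : 1 ∈ K :=
    ⟨fun _ => ⟨0, hm⟩, fun _ => ⟨0, hn⟩, Function.injective_of_subsingleton _,
      Function.injective_of_subsingleton _,
      1, fun τ => by rw [Subsingleton.elim τ 1], fun τ _ => Subsingleton.elim τ 1⟩
  have hb : BddAbove K := by
    refine ⟨m, ?_⟩
    rintro k ⟨r, -, hr, -⟩
    simpa using Fintype.card_le_of_injective r hr
  subst hk
  exact ⟨le_csSup hb h1, Nat.sSup_mem ⟨1, h1⟩ hb⟩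

/-- Lower bound on the volume of the Hilbert outer parallel body of a tropical polytope
with integer generators, in terms of its tropical rank `k`:
`Vol(tconv(A) + B_H(ε)) ≥ 2^((k−m)/2) · κ_(m−k) · k^(2−k) · ε^(m−k)`. -/
theorem stmt11 (m n : ℕ) (hm : 2 ≤ m) (hn : 1 ≤ n) (A : Fin m → Fin n → ℤ)
    (k : ℕ) (hk : k = tropRank m n (fun i j => (A i j : ℝ)))
    (R : ℝ)
    (hRdef : R = ⨆ i : Fin m, ((⨆ j, ((A i j : ℝ) - (A ⟨0, by omega⟩ j : ℝ))) -
        ⨅ j, ((A i j : ℝ) - (A ⟨0, by omega⟩ j : ℝ))))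
    (ε : ℝ) (hε : 0 < ε) (hεR : ε ≤ R * Real.sqrt ((m : ℝ) - 1)) :
    ENNReal.ofReal ((2 : ℝ) ^ (((k : ℝ) - (m : ℝ)) / 2) * kappa (m - k) *
        (k : ℝ) ^ ((2 : ℝ) - (k : ℝ)) * ε ^ (m - k)) ≤
      volume (tconv m (fun i j => (A i j : ℝ)) + hilbertBall (m - 1) ε) := by
  obtain ⟨d, rfl⟩ : ∃ d, m = d + 1 := ⟨m - 1, by omega⟩
  obtain ⟨hk1, r, c, hr, hc, hns⟩ :=
    exists_tropNonsingular_of_eq_tropRank (by omega) hn (fun i j => (A i j : ℝ)) hk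
  obtain ⟨q, rfl⟩ : ∃ q, k = q + 1 := ⟨k - 1, by omega⟩
  have hqd : q + 1 ≤ d + 1 := by simpa using Fintype.card_le_of_injective r hr
  obtain ⟨v, hv⟩ := exists_tropical_combination A r c hk1 hc hns
  set T : Set (Fin (d + 1) → ℝ) :=
    {x | ∃ α : Fin n → ℝ, ∀ i, x i = ⨅ j, (α j + A i j)}
  set δ : ℝ := 1 / (q + 1 : ℕ)
  have hδ : 0 ≤ δ := by positivity
  have hsub : chart '' T ⊆ tconv (d + 1) (fun i j => (A i j : ℝ)) := by
    rintro _ ⟨x, ⟨α, hα⟩, rfl⟩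
    exact ⟨α, fun l => congrArg₂ (· - ·) (hα l.succ) (hα 0)⟩
  have hvol := volume_chart_image_add_hilbertBall_ge T r hr v hδ hε.le fun t ht => by
    obtain ⟨α, hα⟩ := hv t ht
    exact ⟨_, ⟨α, fun i => rfl⟩, hα⟩
  refine le_trans ?_ (hvol.trans (measure_mono (Set.add_subset_add_right hsub)))
  refine le_trans ?_ (mul_le_mul' (le_volume_hilbertBall q hδ)
    (kappa_mul_pow_le_volume_hilbertBall (d - q) hε.le))
  rw [← ENNReal.ofReal_mul (by positivity)]
  refine ENNReal.ofReal_le_ofReal (le_of_eq ?_)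
  have hq : (0 : ℝ) < (q + 1 : ℕ) := by positivity
  have h1 : (2 : ℝ) ^ ((((q + 1 : ℕ) : ℝ) - ((d + 1 : ℕ) : ℝ)) / 2) = (1 / √2) ^ (d - q) := by
    rw [Real.sqrt_eq_rpow, one_div, ← Real.rpow_neg (by norm_num),
      ← Real.rpow_mul_natCast (by norm_num), Nat.cast_sub (by omega)]
    congr 1
    push_cast
    ring
  have h2 : ((q + 1 : ℕ) : ℝ) ^ ((2 : ℝ) - ((q + 1 : ℕ) : ℝ)) = (q + 1) * δ ^ q := by
    rw [show (2 : ℝ) - ((q + 1 : ℕ) : ℝ) = 1 - (q : ℝ) by push_cast; ring, Real.rpow_sub hq,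
      Real.rpow_one, Real.rpow_natCast]
    simp only [δ, one_div, inv_pow]
    push_cast
    ring
  rw [h1, h2, Nat.add_sub_add_right, div_eq_mul_one_div ε, mul_pow ε]
  ring
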